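/- arXiv:2401.08041 — 7 statements merged into one kernel-verified Lean document; each statement's English description precedes it below -/
import Mathlib

section
/- Delay-based lower bound on the inner workload-allocation cost: let d_min = min_{j∈J} d_j and assume s ≥ 0 and s ≥ ρ d_j for all j ∈ J. Then every primal-feasible point (x, u) satisfies ρ Σ_{j∈J} d_j x_j + s u ≥ [ s + (ρ − s/d_min) Δ ] λ. -/
/-- Delay-based lower bound on the inner workload-allocation cost, with
`d_min = min_{j ∈ J} d j`. -/
theorem delay_lower_bound_inner_lp
    {ι : Type*} [Fintype ι] [Nonempty ι]
    (d C y : ι → ℝ) (lam s ρ Δ : ℝ)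
    (hd : ∀ j, 0 < d j) (hC : ∀ j, 0 ≤ C j) (hy : ∀ j, y j = 0 ∨ y j = 1)
    (hlam : 0 ≤ lam) (hρ : 0 ≤ ρ) (hΔ : 0 ≤ Δ)
    (hs0 : 0 ≤ s) (hs : ∀ j, ρ * d j ≤ s)
    -- primal-feasible point (x, u)
    (x : ι → ℝ) (u : ℝ)
    (hx : ∀ j, 0 ≤ x j) (hu : 0 ≤ u) (hxc : ∀ j, x j ≤ C j * y j)
    (hbal : u + ∑ j, x j = lam) (hdel : ∑ j, d j * x j ≤ Δ * lam) :
    ρ * ∑ j, d j * x j + s * u ≥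
      (s + (ρ - s / Finset.univ.inf' Finset.univ_nonempty d) * Δ) * lam := by
  obtain ⟨k, -, hk⟩ := Finset.exists_mem_eq_inf' (Finset.univ_nonempty (α := ι)) d
  have hmin : ∀ j, Finset.univ.inf' Finset.univ_nonempty d ≤ d j :=
    fun j => Finset.inf'_le d (Finset.mem_univ j)
  rw [hk] at hmin ⊢
  have hdk := hd k
  have hsum : d k * ∑ j, x j ≤ ∑ j, d j * x j := by
    rw [Finset.mul_sum]
    exact Finset.sum_le_sum fun j _ => mul_le_mul_of_nonneg_right (hmin j) (hx j)
  have hρk : ρ ≤ s / d k := (le_div_iff₀ hdk).2 (hs k)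
  have hload : s * ∑ j, x j ≤ s / d k * ∑ j, d j * x j := by
    calc s * ∑ j, x j = s / d k * (d k * ∑ j, x j) := by field_simp
      _ ≤ _ := mul_le_mul_of_nonneg_left hsum (by positivity)
  have hdelay := mul_le_mul_of_nonneg_left hdel (sub_nonneg.2 hρk)
  have hu_eq : u = lam - ∑ j, x j := by linarith
  rw [hu_eq]
  linarith
end

section
/- Per-location lower bound on the inner workload-allocation cost: fix j* ∈ J, assume ρ ≥ 0 and s ≥ ρ d_{j*}. Then every primal-feasible point (x, u) satisfies ρ Σ_{j∈J} d_j x_j + s u ≥ ρ d_{j*} λ + ρ Σ_{j∈J : d_j < d_{j*}} C_j y_j (d_j − d_{j*}). -/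
/-- Per-location lower bound on the inner workload-allocation cost: for a fixed
`j* ∈ J`, assuming `ρ ≥ 0` and `s ≥ ρ d_{j*}`. -/
theorem per_location_lower_bound_inner_lp
    {ι : Type*} [Fintype ι] [Nonempty ι]
    (d C y : ι → ℝ) (lam s ρ Δ : ℝ)
    (hd : ∀ j, 0 < d j) (hC : ∀ j, 0 ≤ C j) (hy : ∀ j, y j = 0 ∨ y j = 1)
    (hlam : 0 ≤ lam) (hρ : 0 ≤ ρ) (hΔ : 0 ≤ Δ)
    (jstar : ι) (hs : ρ * d jstar ≤ s)
    -- primal-feasible point (x, u)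
    (x : ι → ℝ) (u : ℝ)
    (hx : ∀ j, 0 ≤ x j) (hu : 0 ≤ u) (hxc : ∀ j, x j ≤ C j * y j)
    (hbal : u + ∑ j, x j = lam) (hdel : ∑ j, d j * x j ≤ Δ * lam) :
    ρ * ∑ j, d j * x j + s * u ≥
      ρ * d jstar * lam +
        ρ * ∑ j ∈ Finset.univ.filter (fun j => d j < d jstar),
          C j * y j * (d j - d jstar) := by
  have key : ∑ j ∈ Finset.univ.filter (fun j => d j < d jstar), C j * y j * (d j - d jstar)
      ≤ ∑ j, (d j * x j - d jstar * x j) := by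
    rw [Finset.sum_filter]
    refine Finset.sum_le_sum fun j _ => ?_
    split_ifs with h
    · nlinarith [mul_nonneg (sub_nonneg.2 (hxc j)) (sub_nonneg.2 h.le)]
    · nlinarith [mul_nonneg (hx j) (sub_nonneg.2 (not_lt.1 h))]
  rw [Finset.sum_sub_distrib, ← Finset.mul_sum] at key
  have hcost := mul_le_mul_of_nonneg_left key hρ
  have hunmet := mul_le_mul_of_nonneg_right hs hu
  rw [← hbal]
  linarith
end

section
/- Combined per-location lower bound on the inner workload-allocation cost: let d_min = min_{j∈J} d_j, fix j* ∈ J, and assume ρ ≥ 0 and s ≥ ρ d_{j*}. Then every primal-feasible point (x, u) satisfies ρ Σ_{j∈J} d_j x_j + s u ≥ ρ d_{j*} λ + max{ (ρ − ρ d_{j*}/d_min) Δ λ , ρ Σ_{j∈J : d_j < d_{j*}} C_j y_j (d_j − d_{j*}) }. -/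
/-- Combined per-location lower bound on the inner workload-allocation cost, with
`d_min = min_{j ∈ J} d j` and a fixed `j* ∈ J`. -/
theorem combined_per_location_lower_bound_inner_lp
    {ι : Type*} [Fintype ι] [Nonempty ι]
    (d C y : ι → ℝ) (lam s ρ Δ : ℝ)
    (hd : ∀ j, 0 < d j) (hC : ∀ j, 0 ≤ C j) (hy : ∀ j, y j = 0 ∨ y j = 1)
    (hlam : 0 ≤ lam) (hρ : 0 ≤ ρ) (hΔ : 0 ≤ Δ)
    (jstar : ι) (hs : ρ * d jstar ≤ s)
    -- primal-feasible point (x, u)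
    (x : ι → ℝ) (u : ℝ)
    (hx : ∀ j, 0 ≤ x j) (hu : 0 ≤ u) (hxc : ∀ j, x j ≤ C j * y j)
    (hbal : u + ∑ j, x j = lam) (hdel : ∑ j, d j * x j ≤ Δ * lam) :
    ρ * ∑ j, d j * x j + s * u ≥
      ρ * d jstar * lam +
        max ((ρ - ρ * d jstar / Finset.univ.inf' Finset.univ_nonempty d) * Δ * lam)
          (ρ * ∑ j ∈ Finset.univ.filter (fun j => d j < d jstar),
            C j * y j * (d j - d jstar)) := by
  have key : ρ * d jstar * lam + ρ * ∑ j, x j * (d j - d jstar) ≤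
      ρ * ∑ j, d j * x j + s * u := by
    have hsum : ∑ j, x j * (d j - d jstar) = ∑ j, d j * x j - d jstar * ∑ j, x j := by
      rw [Finset.mul_sum, ← Finset.sum_sub_distrib]
      exact Finset.sum_congr rfl fun j _ => by ring
    rw [hsum, ← hbal]
    nlinarith [mul_le_mul_of_nonneg_right hs hu]
  refine le_trans (add_le_add le_rfl (max_le ?_ ?_)) key
  · set m := Finset.univ.inf' Finset.univ_nonempty d
    have hmle : ∀ j, m ≤ d j := fun j => Finset.inf'_le d (Finset.mem_univ j)
    have hmpos : 0 < m := (Finset.lt_inf'_iff _).2 fun j _ => hd j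
    have hcoef : ρ - ρ * d jstar / m ≤ 0 := by
      rw [sub_nonpos, le_div_iff₀ hmpos]
      exact mul_le_mul_of_nonneg_left (hmle jstar) hρ
    calc (ρ - ρ * d jstar / m) * Δ * lam
        = (ρ - ρ * d jstar / m) * (Δ * lam) := by ring
      _ ≤ (ρ - ρ * d jstar / m) * ∑ j, d j * x j := mul_le_mul_of_nonpos_left hdel hcoef
      _ = ρ * ∑ j, (1 - d jstar / m) * (d j * x j) := by
        rw [← Finset.mul_sum]
        ring
      _ ≤ ρ * ∑ j, x j * (d j - d jstar) := by
        refine mul_le_mul_of_nonneg_left (Finset.sum_le_sum fun j _ => ?_) hρ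
        have hratio : 1 ≤ d j / m := (one_le_div hmpos).2 (hmle j)
        have h := mul_le_mul_of_nonneg_left hratio (mul_nonneg (hd jstar).le (hx j))
        have e : (1 - d jstar / m) * (d j * x j) =
            d j * x j - d jstar * x j * (d j / m) := by ring
        rw [e]
        linarith
  · refine mul_le_mul_of_nonneg_left ?_ hρ
    rw [Finset.sum_filter]
    refine Finset.sum_le_sum fun j _ => ?_
    split_ifs with h
    · exact mul_le_mul_of_nonpos_right (hxc j) (sub_nonpos.2 h.le)
    · exact mul_nonneg (hx j) (sub_nonneg.2 (not_lt.1 h))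
end

section
/- Strong duality for the inner workload-allocation linear program: assume s ≥ 0. Then the infimum of the primal objective over all primal-feasible points equals the supremum of the dual objective over all dual-feasible points, and both the infimum and the supremum are attained. -/
lemma nonpos_of_forall_mul_lt {l K : ℝ} (h : ∀ t : ℝ, 0 < t → l * t < K) : l ≤ 0 := by
  by_contra! hl
  have h1 := h ((|K| + 1) / l) (by positivity)
  rw [mul_div_cancel₀ _ hl.ne'] at h1
  linarith [le_abs_self K]

/-- Lagrange multipliers for a convex program with two inequality constraints satisfying
Slater's condition. -/
theorem exists_lagrange_multipliers_of_slater {E : Type*} [AddCommGroup E] [Module ℝ E]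
    {X : Set E} {f g h : E → ℝ} (hf : ConvexOn ℝ X f) (hg : ConvexOn ℝ X g)
    (hh : ConvexOn ℝ X h) {x₀ : E} (hx₀ : x₀ ∈ X) (hg₀ : g x₀ < 0) (hh₀ : h x₀ < 0) {p : ℝ}
    (hp : ∀ x ∈ X, g x ≤ 0 → h x ≤ 0 → p ≤ f x) :
    ∃ μ ν : ℝ, 0 ≤ μ ∧ 0 ≤ ν ∧ ∀ x ∈ X, p ≤ f x + μ * g x + ν * h x := by
  let A : Set (ℝ × ℝ × ℝ) := ⋃ x ∈ X, Set.Ioi (f x) ×ˢ Set.Ioi (g x) ×ˢ Set.Ioi (h x)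
  have mem_A {r a b : ℝ} : (r, a, b) ∈ A ↔ ∃ x ∈ X, f x < r ∧ g x < a ∧ h x < b := by
    simp only [A, Set.mem_iUnion, Set.mem_prod, Set.mem_Ioi, exists_prop]
  have hA_open : IsOpen A :=
    isOpen_biUnion fun x _ => isOpen_Ioi.prod (isOpen_Ioi.prod isOpen_Ioi)
  have hA_convex : Convex ℝ A := by
    have strict {k : E → ℝ} (hk : ConvexOn ℝ X k) {x y : E} (hx : x ∈ X) (hy : y ∈ X)
        {a b r t : ℝ} (ha : 0 ≤ a) (hb : 0 ≤ b) (hab : a + b = 1) (hr : k x < r)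
        (ht : k y < t) : k (a • x + b • y) < a * r + b * t := by
      refine (hk.2 hx hy ha hb hab).trans_lt ?_
      simp only [smul_eq_mul]
      rcases ha.eq_or_lt with rfl | ha
      · obtain rfl : b = 1 := by linarith
        simpa using ht
      · have := mul_lt_mul_of_pos_left hr ha
        have := mul_le_mul_of_nonneg_left ht.le hb
        linarith
    rintro ⟨r, r', r''⟩ hr ⟨t, t', t''⟩ ht a b ha hb hab
    obtain ⟨x, hx, h1, h2, h3⟩ := mem_A.1 hr
    obtain ⟨y, hy, k1, k2, k3⟩ := mem_A.1 ht
    exact mem_A.2 ⟨a • x + b • y, hf.1 hx hy ha hb hab, strict hf hx hy ha hb hab h1 k1,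
      strict hg hx hy ha hb hab h2 k2, strict hh hx hy ha hb hab h3 k3⟩
  have hpA : (p, (0 : ℝ), (0 : ℝ)) ∉ A := by
    intro hmem
    obtain ⟨x, hx, h1, h2, h3⟩ := mem_A.1 hmem
    exact (hp x hx h2.le h3.le).not_gt h1
  obtain ⟨φ, hφ⟩ := geometric_hahn_banach_open_point hA_convex hA_open hpA
  obtain ⟨l, m, n, hlmn⟩ : ∃ l m n : ℝ, ∀ r a b, φ (r, a, b) = l * r + m * a + n * b := by
    refine ⟨φ (1, 0, 0), φ (0, 1, 0), φ (0, 0, 1), fun r a b => ?_⟩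
    have : ((r, a, b) : ℝ × ℝ × ℝ) = r • (1, 0, 0) + a • (0, 1, 0) + b • (0, 0, 1) := by simp
    rw [this, map_add, map_add, map_smul, map_smul, map_smul]
    simp only [smul_eq_mul]
    ring
  have sep (x : E) (hx : x ∈ X) (e₁ e₂ e₃ : ℝ) (h₁ : 0 < e₁) (h₂ : 0 < e₂) (h₃ : 0 < e₃) :
      l * (f x + e₁) + m * (g x + e₂) + n * (h x + e₃) < l * p := by
    have := hφ _ (mem_A.2 ⟨x, hx, lt_add_of_pos_right _ h₁, lt_add_of_pos_right _ h₂,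
      lt_add_of_pos_right _ h₃⟩)
    rw [hlmn, hlmn] at this
    linarith
  have hl : l ≤ 0 := nonpos_of_forall_mul_lt
    (K := l * p - l * f x₀ - m * (g x₀ + 1) - n * (h x₀ + 1)) fun t ht => by
      linarith [sep x₀ hx₀ t 1 1 ht one_pos one_pos]
  have hm : m ≤ 0 := nonpos_of_forall_mul_lt
    (K := l * p - l * (f x₀ + 1) - m * g x₀ - n * (h x₀ + 1)) fun t ht => by
      linarith [sep x₀ hx₀ 1 t 1 one_pos ht one_pos]
  have hn : n ≤ 0 := nonpos_of_forall_mul_lt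
    (K := l * p - l * (f x₀ + 1) - m * (g x₀ + 1) - n * h x₀) fun t ht => by
      linarith [sep x₀ hx₀ 1 1 t one_pos one_pos ht]
  have hl_neg : l < 0 := by
    refine hl.lt_of_ne fun hl0 => ?_
    have := sep x₀ hx₀ 1 (-g x₀ / 2) (-h x₀ / 2) one_pos (by linarith) (by linarith)
    rw [hl0] at this
    have := mul_nonneg_of_nonpos_of_nonpos hm hg₀.le
    have := mul_nonneg_of_nonpos_of_nonpos hn hh₀.le
    linarith
  refine ⟨m / l, n / l, div_nonneg_of_nonpos hm hl, div_nonneg_of_nonpos hn hl, fun x hx => ?_⟩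
  have key : l * f x + m * g x + n * h x ≤ l * p := by
    refine le_of_forall_pos_lt_add fun ε hε => ?_
    have hD : 0 < 1 - l - m - n := by linarith
    have he : 0 < ε / (1 - l - m - n) := div_pos hε hD
    have := sep x hx _ _ _ he he he
    have : ε / (1 - l - m - n) * (1 - l - m - n) = ε := div_mul_cancel₀ _ hD.ne'
    linarith
  have hmul : l * (f x + m / l * g x + n / l * h x) = l * f x + m * g x + n * h x := by
    have := hl_neg.ne
    field_simp
  exact (mul_le_mul_left_of_neg hl_neg).1 (hmul.trans_le key)

section InnerLP

variable {ι : Type*} [Fintype ι] {d c x v : ι → ℝ} {lam s ρ Δ u α β : ℝ}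

theorem innerLP_weak_duality (hx : ∀ j, 0 ≤ x j) (hu : 0 ≤ u) (hxc : ∀ j, x j ≤ c j)
    (hsum : u + ∑ j, x j = lam) (hdelay : ∑ j, d j * x j ≤ Δ * lam)
    (hv : ∀ j, v j ≤ 0) (hα : α ≤ s) (hβ : β ≤ 0)
    (hdual : ∀ j, v j + α + β * d j ≤ ρ * d j) :
    ∑ j, c j * v j + (α + β * Δ) * lam ≤ ρ * ∑ j, d j * x j + s * u := by
  have hterm : ∑ j, (c j * v j + α * x j + β * (d j * x j)) ≤ ∑ j, ρ * (d j * x j) :=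
    Finset.sum_le_sum fun j _ => by
      linarith [mul_le_mul_of_nonpos_right (hxc j) (hv j),
        mul_le_mul_of_nonneg_right (hdual j) (hx j)]
  simp only [Finset.sum_add_distrib, ← Finset.mul_sum] at hterm
  have h1 := mul_le_mul_of_nonneg_right hα hu
  have h2 := mul_le_mul_of_nonpos_left hdelay hβ
  have h3 : α * lam = α * u + α * ∑ j, x j := by rw [← hsum]; ring
  linarith

theorem innerLP_exists_dual_of_pos (hc : ∀ j, 0 ≤ c j) (hlam : 0 < lam) (hΔ : 0 < Δ) :
    ∃ x : ι → ℝ, ∃ u : ℝ, ∃ v : ι → ℝ, ∃ α β : ℝ,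
      ((∀ j, 0 ≤ x j) ∧ 0 ≤ u ∧ (∀ j, x j ≤ c j) ∧ u + ∑ j, x j = lam ∧
        ∑ j, d j * x j ≤ Δ * lam) ∧
      ((∀ j, v j ≤ 0) ∧ α ≤ s ∧ β ≤ 0 ∧ ∀ j, v j + α + β * d j ≤ ρ * d j) ∧
      ρ * ∑ j, d j * x j + s * u ≤ ∑ j, c j * v j + (α + β * Δ) * lam := by
  classical
  let f : (ι → ℝ) → ℝ := fun x => ∑ j, (ρ * d j - s) * x j
  let g : (ι → ℝ) → ℝ := fun x => ∑ j, x j - lam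
  let h : (ι → ℝ) → ℝ := fun x => ∑ j, d j * x j - Δ * lam
  have convex_affine (w : ι → ℝ) (k : ℝ) :
      ConvexOn ℝ (Set.Icc 0 c) fun x => ∑ j, w j * x j - k := by
    refine ⟨convex_Icc _ _, fun x _ y _ a b _ _ hab => le_of_eq ?_⟩
    simp only [Pi.add_apply, Pi.smul_apply, smul_eq_mul, mul_add, Finset.sum_add_distrib,
      mul_sub, mul_left_comm _ a, mul_left_comm _ b, ← Finset.mul_sum]
    linear_combination k * hab
  have hf : ConvexOn ℝ (Set.Icc 0 c) f := by simpa using convex_affine (fun j => ρ * d j - s) 0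
  have hg : ConvexOn ℝ (Set.Icc 0 c) g := by simpa using convex_affine 1 lam
  have hh : ConvexOn ℝ (Set.Icc 0 c) h := convex_affine d (Δ * lam)
  have hΔlam : 0 < Δ * lam := mul_pos hΔ hlam
  have h0 : (0 : ι → ℝ) ∈ Set.Icc 0 c := ⟨le_rfl, hc⟩
  have hcompact : IsCompact (Set.Icc 0 c ∩ {x | g x ≤ 0 ∧ h x ≤ 0}) :=
    isCompact_Icc.inter_right <|
      (isClosed_le (show Continuous g by fun_prop) continuous_const).inter
        (isClosed_le (show Continuous h by fun_prop) continuous_const)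
  obtain ⟨x, ⟨hx, hgx, hhx⟩, hmin⟩ := hcompact.exists_isMinOn
    ⟨0, h0, by simpa [g] using hlam.le, by simpa [h] using hΔlam.le⟩
    (show Continuous f by fun_prop).continuousOn
  obtain ⟨μ, ν, hμ, hν, hopt⟩ := exists_lagrange_multipliers_of_slater hf hg hh h0
    (by simpa [g] using hlam) (by simpa [h] using hΔlam) (p := f x)
    fun y hy hgy hhy => hmin ⟨hy, hgy, hhy⟩
  let r : ι → ℝ := fun j => ρ * d j - s + μ + ν * d j
  refine ⟨x, lam - ∑ j, x j, fun j => min 0 (r j), s - μ, -ν,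
    ⟨hx.1, by simp only [g] at hgx; linarith, hx.2, by ring, sub_nonpos.1 hhx⟩,
    ⟨fun j => min_le_left _ _, by linarith, by linarith, fun j => ?_⟩, ?_⟩
  · have := min_le_right 0 (r j)
    simp only [r] at this ⊢
    linarith
  · let z : ι → ℝ := fun j => if r j < 0 then c j else 0
    have hz : z ∈ Set.Icc 0 c := by
      constructor <;> intro j <;> by_cases hj : r j < 0 <;> simp [z, hj, hc j]
    have hzr : ∑ j, c j * min 0 (r j) = ∑ j, r j * z j :=
      Finset.sum_congr rfl fun j _ => by
        by_cases hj : r j < 0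
        · simp [z, hj, min_eq_right hj.le, mul_comm]
        · simp [z, hj, min_eq_left (not_lt.1 hj)]
    have hexpand : ∑ j, r j * z j = f z + μ * ∑ j, z j + ν * ∑ j, d j * z j := by
      simp only [f, r, Finset.mul_sum, ← Finset.sum_add_distrib]
      exact Finset.sum_congr rfl fun j _ => by ring
    have hfx : f x = ρ * ∑ j, d j * x j - s * ∑ j, x j := by
      simp only [f, Finset.mul_sum, ← Finset.sum_sub_distrib]
      exact Finset.sum_congr rfl fun j _ => by ring
    have hoptz := hopt z hz
    simp only [g, h] at hoptz
    rw [hzr, hexpand]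
    linarith

theorem innerLP_exists_dual_of_mul_eq_zero (hc : ∀ j, 0 ≤ c j) (hd : ∀ j, 0 < d j)
    (hlam : 0 ≤ lam) (hρ : 0 ≤ ρ) (hs : 0 ≤ s) (hΔlam : Δ * lam = 0) :
    ∃ x : ι → ℝ, ∃ u : ℝ, ∃ v : ι → ℝ, ∃ α β : ℝ,
      ((∀ j, 0 ≤ x j) ∧ 0 ≤ u ∧ (∀ j, x j ≤ c j) ∧ u + ∑ j, x j = lam ∧
        ∑ j, d j * x j ≤ Δ * lam) ∧
      ((∀ j, v j ≤ 0) ∧ α ≤ s ∧ β ≤ 0 ∧ ∀ j, v j + α + β * d j ≤ ρ * d j) ∧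
      ρ * ∑ j, d j * x j + s * u ≤ ∑ j, c j * v j + (α + β * Δ) * lam := by
  have hnn (j : ι) : 0 ≤ s / d j := div_nonneg hs (hd j).le
  refine ⟨0, lam, 0, s, -∑ j, s / d j, ⟨fun _ => le_rfl, hlam, hc, by simp, by simp [hΔlam]⟩,
    ⟨fun _ => le_rfl, le_rfl, neg_nonpos.2 (Finset.sum_nonneg fun j _ => hnn j), fun j => ?_⟩, ?_⟩
  · have hle : s / d j ≤ ∑ i, s / d i :=
      Finset.single_le_sum (f := fun i => s / d i) (fun i _ => hnn i) (Finset.mem_univ j)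
    have h1 := (div_le_iff₀ (hd j)).1 hle
    have h2 := mul_nonneg hρ (hd j).le
    simp only [Pi.zero_apply]
    linarith
  · simp [add_mul, mul_assoc, hΔlam]

end InnerLP

/-- Strong duality for the inner workload-allocation LP: assuming `s ≥ 0`, there is a
common value `m` that is the minimum of the primal objective over primal-feasible points
and the maximum of the dual objective over dual-feasible points; in particular the
primal infimum equals the dual supremum and both are attained. -/
theorem strong_duality_inner_lp
    {ι : Type*} [Fintype ι] [Nonempty ι]
    (d C y : ι → ℝ) (lam s ρ Δ : ℝ)
    (hd : ∀ j, 0 < d j) (hC : ∀ j, 0 ≤ C j) (hy : ∀ j, y j = 0 ∨ y j = 1)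
    (hlam : 0 ≤ lam) (hρ : 0 ≤ ρ) (hΔ : 0 ≤ Δ) (hs : 0 ≤ s) :
    ∃ m : ℝ,
      IsLeast {c : ℝ | ∃ x : ι → ℝ, ∃ u : ℝ,
          (∀ j, 0 ≤ x j) ∧ 0 ≤ u ∧ (∀ j, x j ≤ C j * y j) ∧
          u + ∑ j, x j = lam ∧ (∑ j, d j * x j ≤ Δ * lam) ∧
          c = ρ * ∑ j, d j * x j + s * u} m ∧
      IsGreatest {c : ℝ | ∃ v : ι → ℝ, ∃ α β : ℝ,
          (∀ j, v j ≤ 0) ∧ α ≤ s ∧ β ≤ 0 ∧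
          (∀ j, v j + α + β * d j ≤ ρ * d j) ∧
          c = ∑ j, C j * y j * v j + (α + β * Δ) * lam} m := by
  have hc (j : ι) : 0 ≤ C j * y j := by
    rcases hy j with h | h <;> simp [h, hC j]
  obtain ⟨x, u, v, α, β, ⟨hx, hu, hxc, hsum, hdelay⟩, ⟨hv, hα, hβ, hdual⟩, hle⟩ :
      ∃ x : ι → ℝ, ∃ u : ℝ, ∃ v : ι → ℝ, ∃ α β : ℝ,
        ((∀ j, 0 ≤ x j) ∧ 0 ≤ u ∧ (∀ j, x j ≤ C j * y j) ∧ u + ∑ j, x j = lam ∧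
          ∑ j, d j * x j ≤ Δ * lam) ∧
        ((∀ j, v j ≤ 0) ∧ α ≤ s ∧ β ≤ 0 ∧ ∀ j, v j + α + β * d j ≤ ρ * d j) ∧
        ρ * ∑ j, d j * x j + s * u ≤ ∑ j, C j * y j * v j + (α + β * Δ) * lam := by
    rcases (mul_nonneg hΔ hlam).eq_or_lt with h0 | hpos
    · exact innerLP_exists_dual_of_mul_eq_zero hc hd hlam hρ hs h0.symm
    · exact innerLP_exists_dual_of_pos hc (pos_of_mul_pos_right hpos hΔ)
        (pos_of_mul_pos_left hpos hlam)
  have heq := hle.antisymm (innerLP_weak_duality hx hu hxc hsum hdelay hv hα hβ hdual)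
  refine ⟨_, ⟨⟨x, u, hx, hu, hxc, hsum, hdelay, rfl⟩, ?_⟩,
    ⟨⟨v, α, β, hv, hα, hβ, hdual, heq⟩, ?_⟩⟩
  · rintro _ ⟨x', u', hx', hu', hxc', hsum', hdelay', rfl⟩
    exact heq.trans_le (innerLP_weak_duality hx' hu' hxc' hsum' hdelay' hv hα hβ hdual)
  · rintro _ ⟨v', α', β', hv', hα', hβ', hdual', rfl⟩
    exact innerLP_weak_duality hx hu hxc hsum hdelay hv' hα' hβ' hdual'
end

section
/- Dual feasibility certificate for the per-location delay bound: let d_min = min_{j∈J} d_j, fix j* ∈ J, and assume ρ ≥ 0 and s ≥ ρ d_{j*}. Then the point defined by v_j = 0 for all j, α = ρ d_{j*}, β = ρ − ρ d_{j*}/d_min is dual-feasible, and its dual objective value equals ρ d_{j*} λ + (ρ − ρ d_{j*}/d_min) Δ λ. -/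
/-- Dual feasibility certificate for the per-location delay bound: with
`d_min = min_{j ∈ J} d j` and a fixed `j* ∈ J`, the point `v_j = 0`, `α = ρ d_{j*}`,
`β = ρ − ρ d_{j*}/d_min` is dual-feasible, with dual objective value
`ρ d_{j*} λ + (ρ − ρ d_{j*}/d_min) Δ λ`. -/
theorem dual_certificate_delay_bound
    {ι : Type*} [Fintype ι] [Nonempty ι]
    (d C y : ι → ℝ) (lam s ρ Δ : ℝ)
    (hd : ∀ j, 0 < d j) (hC : ∀ j, 0 ≤ C j) (hy : ∀ j, y j = 0 ∨ y j = 1)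
    (hlam : 0 ≤ lam) (hρ : 0 ≤ ρ) (hΔ : 0 ≤ Δ)
    (jstar : ι) (hs : ρ * d jstar ≤ s)
    (v : ι → ℝ) (α β : ℝ)
    (hvdef : ∀ j, v j = 0) (hαdef : α = ρ * d jstar)
    (hβdef : β = ρ - ρ * d jstar / Finset.univ.inf' Finset.univ_nonempty d) :
    (∀ j, v j ≤ 0) ∧ α ≤ s ∧ β ≤ 0 ∧
    (∀ j, v j + α + β * d j ≤ ρ * d j) ∧
    ∑ j, C j * y j * v j + (α + β * Δ) * lam =
      ρ * d jstar * lam +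
        (ρ - ρ * d jstar / Finset.univ.inf' Finset.univ_nonempty d) * Δ * lam := by
  subst hαdef hβdef
  set m := Finset.univ.inf' Finset.univ_nonempty d
  have hm : 0 < m := (Finset.lt_inf'_iff _).2 fun j _ => hd j
  have hle : ∀ j, m ≤ d j := fun j => Finset.inf'_le d (Finset.mem_univ j)
  have hα : 0 ≤ ρ * d jstar := mul_nonneg hρ (hd jstar).le
  refine ⟨fun j => (hvdef j).le, hs, ?_, fun j => ?_, ?_⟩
  · rw [sub_nonpos, le_div_iff₀ hm]
    exact mul_le_mul_of_nonneg_left (hle jstar) hρ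
  · have h : ρ * d jstar ≤ ρ * d jstar / m * d j := by
      rw [div_mul_eq_mul_div, le_div_iff₀ hm]
      exact mul_le_mul_of_nonneg_left (hle j) hα
    rw [hvdef j]
    linarith
  · simp only [hvdef, mul_zero, Finset.sum_const_zero]
    ring
end

section
/- First valid inequality from the two smallest support points: let N ≥ 2 and 0 ≤ ξ_(1) ≤ ξ_(2) ≤ … ≤ ξ_(N) be an ordered nonnegative support, and let μ, Γ, S, Γ̄ be real numbers. If there exists a probability vector p (p_n ≥ 0, Σ_n p_n = 1) with Σ_n p_n ξ_(n) ≥ μ − Γ and Σ_n p_n ξ_(n)² ≤ S · Γ̄, then ξ_(1) ξ_(2) − (ξ_(1) + ξ_(2)) (μ − Γ) + S · Γ̄ ≥ 0. -/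
/-- First valid inequality from the two smallest support points of an ordered
nonnegative support: if some probability vector has first moment at least `μ − Γ`
and second moment at most `S·Γ̄`, then
`ξ₍₁₎ ξ₍₂₎ − (ξ₍₁₎ + ξ₍₂₎)(μ − Γ) + S·Γ̄ ≥ 0`. -/
theorem first_valid_inequality_two_smallest
    {N : ℕ} (hN : 2 ≤ N) (ξ : Fin N → ℝ)
    (hmono : Monotone ξ) (hnonneg : 0 ≤ ξ ⟨0, by omega⟩)
    (μ Γ S Γbar : ℝ)
    (hex : ∃ p : Fin N → ℝ, (∀ n, 0 ≤ p n) ∧ (∑ n, p n = 1) ∧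
      μ - Γ ≤ ∑ n, p n * ξ n ∧ ∑ n, p n * (ξ n) ^ 2 ≤ S * Γbar) :
    ξ ⟨0, by omega⟩ * ξ ⟨1, by omega⟩ -
      (ξ ⟨0, by omega⟩ + ξ ⟨1, by omega⟩) * (μ - Γ) + S * Γbar ≥ 0 := by
  obtain ⟨p, hp, hsum, hfirst, hsecond⟩ := hex
  have h01 : ξ ⟨0, by omega⟩ ≤ ξ ⟨1, by omega⟩ := hmono (by simp [Fin.le_def])
  generalize ha : ξ ⟨0, by omega⟩ = a at *
  generalize hb : ξ ⟨1, by omega⟩ = b at *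
  have hterm : ∀ n, 0 ≤ (ξ n - a) * (ξ n - b) := by
    intro n
    rcases Nat.eq_zero_or_pos n.val with h | h
    · have hn : ξ n = a := by rw [← ha]; congr 1; exact Fin.ext h
      simp [hn]
    · have hn : b ≤ ξ n := hb ▸ hmono (Fin.le_def.mpr h)
      exact mul_nonneg (by linarith) (by linarith)
  have hexpand : ∑ n, p n * ((ξ n - a) * (ξ n - b)) =
      ∑ n, p n * ξ n ^ 2 - (a + b) * ∑ n, p n * ξ n + a * b * ∑ n, p n := by
    rw [Finset.mul_sum, Finset.mul_sum, ← Finset.sum_sub_distrib, ← Finset.sum_add_distrib]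
    exact Finset.sum_congr rfl fun n _ => by ring
  have hpos : 0 ≤ ∑ n, p n * ((ξ n - a) * (ξ n - b)) :=
    Finset.sum_nonneg fun n _ => mul_nonneg (hp n) (hterm n)
  have hmean : (a + b) * (μ - Γ) ≤ (a + b) * ∑ n, p n * ξ n :=
    mul_le_mul_of_nonneg_left hfirst (by linarith)
  rw [hexpand, hsum] at hpos
  linarith
end

section
/- Second valid inequality from the two largest support points: let N ≥ 2 and 0 ≤ ξ_(1) ≤ ξ_(2) ≤ … ≤ ξ_(N) be an ordered nonnegative support, and let μ, Γ, S, Γ̄ be real numbers. If there exists a probability vector p (p_n ≥ 0, Σ_n p_n = 1) with Σ_n p_n ξ_(n) ≥ μ − Γ and Σ_n p_n ξ_(n)² ≤ S · Γ̄, then ξ_(N−1) ξ_(N) − (ξ_(N−1) + ξ_(N)) (μ − Γ) + S · Γ̄ ≥ 0. -/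
/-- Second valid inequality from the two largest support points of an ordered
nonnegative support: if some probability vector has first moment at least `μ − Γ`
and second moment at most `S·Γ̄`, then
`ξ₍N₋₁₎ ξ₍N₎ − (ξ₍N₋₁₎ + ξ₍N₎)(μ − Γ) + S·Γ̄ ≥ 0`. -/
theorem second_valid_inequality_two_largest
    {N : ℕ} (hN : 2 ≤ N) (ξ : Fin N → ℝ)
    (hmono : Monotone ξ) (hnonneg : 0 ≤ ξ ⟨0, by omega⟩)
    (μ Γ S Γbar : ℝ)
    (hex : ∃ p : Fin N → ℝ, (∀ n, 0 ≤ p n) ∧ (∑ n, p n = 1) ∧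
      μ - Γ ≤ ∑ n, p n * ξ n ∧ ∑ n, p n * (ξ n) ^ 2 ≤ S * Γbar) :
    ξ ⟨N - 2, by omega⟩ * ξ ⟨N - 1, by omega⟩ -
      (ξ ⟨N - 2, by omega⟩ + ξ ⟨N - 1, by omega⟩) * (μ - Γ) + S * Γbar ≥ 0 := by
  obtain ⟨p, hp, hsum, hfirst, hsecond⟩ := hex
  set a := ξ ⟨N - 2, by omega⟩
  set b := ξ ⟨N - 1, by omega⟩ with hb
  have ha0 : 0 ≤ a := hnonneg.trans (hmono (Fin.mk_le_mk.mpr (Nat.zero_le _)))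
  have hb0 : 0 ≤ b := hnonneg.trans (hmono (Fin.mk_le_mk.mpr (Nat.zero_le _)))
  have hgap : ∀ n, 0 ≤ (a - ξ n) * (b - ξ n) := by
    intro n
    have hnb : ξ n ≤ b := hmono (Fin.le_def.mpr (by have := n.isLt; simp only; omega))
    by_cases hn : (n : ℕ) ≤ N - 2
    · have hna : ξ n ≤ a := hmono (Fin.le_def.mpr hn)
      exact mul_nonneg (sub_nonneg.mpr hna) (sub_nonneg.mpr hnb)
    · have hlast : n = ⟨N - 1, by omega⟩ := Fin.ext (by have := n.isLt; simp only; omega)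
      simp [hlast, hb]
  have hexpect : 0 ≤ ∑ n, p n * ((a - ξ n) * (b - ξ n)) :=
    Finset.sum_nonneg fun n _ => mul_nonneg (hp n) (hgap n)
  have hexpand : ∑ n, p n * ((a - ξ n) * (b - ξ n)) =
      a * b * ∑ n, p n - (a + b) * ∑ n, p n * ξ n + ∑ n, p n * ξ n ^ 2 := by
    simp only [Finset.mul_sum, ← Finset.sum_sub_distrib, ← Finset.sum_add_distrib]
    exact Finset.sum_congr rfl fun n _ => by ring
  rw [hexpand, hsum] at hexpect
  have hmoment := mul_le_mul_of_nonneg_left hfirst (add_nonneg ha0 hb0)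
  linarith
end
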